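/- arXiv:2507.07782 — 2 statements merged into one kernel-verified Lean document; each statement's English description precedes it below -/
import Mathlib

section
/- Let (X,d) be a compact metric space, f : X → X continuous, and φ, ψ ∈ C(X,ℝ) with 0 < m ≤ ψ(x) ≤ M for all x ∈ X. Then each of the following quantities equals the ψ-induced topological pressure P_ψ(φ): (i) lim_{δ→0} sup_α limsup_{T→∞} (1/T) log p_{ψ,T}(f,φ,α), where the supremum is over all open covers α of X with diam(α) ≤ δ; (ii) lim_{δ→0} sup_α limsup_{T→∞} (1/T) log q_{ψ,T}(f,φ,α), where the supremum is over all open covers α of X with diam(α) ≤ δ; (iii) sup_α limsup_{T→∞} (1/T) log q_{ψ,T}(f,φ,α), where the supremum is over all open covers α of X. -/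
open Filter Set Topology MeasureTheory ENNReal

variable {X : Type*}

/-- Birkhoff sum `S_n φ = ∑_{i<n} φ ∘ f^i`. -/
def birkhoff (f : X → X) (φ : X → ℝ) (n : ℕ) (x : X) : ℝ :=
  ∑ i ∈ Finset.range n, φ (f^[i] x)

section Metric
variable [MetricSpace X]

/-- `F` is an `(n,ε)`-spanning set of `Z`: every `y ∈ Z` is within Bowen distance
`d_n ≤ ε` of some point of `F`. -/
def IsSpanningSetOf (f : X → X) (n : ℕ) (ε : ℝ) (Z : Set X) (F : Finset X) : Prop :=
  ∀ y ∈ Z, ∃ x ∈ F, ∀ i < n, dist (f^[i] x) (f^[i] y) ≤ ε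

/-- `E` is an `(n,ε)`-separated set of `Z`: `E ⊆ Z` and distinct points of `E` are at
Bowen distance `d_n > ε`. -/
def IsSeparatedSetOf (f : X → X) (n : ℕ) (ε : ℝ) (Z : Set X) (E : Finset X) : Prop :=
  (E : Set X) ⊆ Z ∧ ∀ x ∈ E, ∀ y ∈ E, x ≠ y → ∃ i < n, ε < dist (f^[i] x) (f^[i] y)

/-- `S_T = {n : ℕ | ∃ x, S_nψ(x) ≤ T < S_{n+1}ψ(x)}`. -/
def inducedST (f : X → X) (ψ : X → ℝ) (T : ℝ) : Set ℕ :=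
  {n | ∃ x : X, birkhoff f ψ n x ≤ T ∧ T < birkhoff f ψ (n + 1) x}

/-- `X_n = {x | S_nψ(x) ≤ T < S_{n+1}ψ(x)}`. -/
def inducedXn (f : X → X) (ψ : X → ℝ) (T : ℝ) (n : ℕ) : Set X :=
  {x | birkhoff f ψ n x ≤ T ∧ T < birkhoff f ψ (n + 1) x}

/-- `Q_{ψ,T}(f,φ,ε)`: infimum over families of `(n,ε)`-spanning sets of the `X_n`, `n ∈ S_T`,
of `∑_{n ∈ S_T} ∑_{x ∈ F_n} e^{S_nφ(x)}`. -/
noncomputable def inducedQ (f : X → X) (ψ φ : X → ℝ) (T ε : ℝ) : ℝ≥0∞ :=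
  ⨅ (F : ℕ → Finset X) (_ : ∀ n ∈ inducedST f ψ T,
      IsSpanningSetOf f n ε (inducedXn f ψ T n) (F n)),
    ∑' n : inducedST f ψ T, ∑ x ∈ F n, ENNReal.ofReal (Real.exp (birkhoff f φ n x))

/-- `P_{ψ,T}(f,φ,ε)`: supremum over families of `(n,ε)`-separated sets of the `X_n`, `n ∈ S_T`,
of `∑_{n ∈ S_T} ∑_{x ∈ E_n} e^{S_nφ(x)}`. -/
noncomputable def inducedPsep (f : X → X) (ψ φ : X → ℝ) (T ε : ℝ) : ℝ≥0∞ :=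
  ⨆ (E : ℕ → Finset X) (_ : ∀ n ∈ inducedST f ψ T,
      IsSeparatedSetOf f n ε (inducedXn f ψ T n) (E n)),
    ∑' n : inducedST f ψ T, ∑ x ∈ E n, ENNReal.ofReal (Real.exp (birkhoff f φ n x))

/-- The ψ-induced topological pressure
`P_ψ(φ) = lim_{ε→0⁺} limsup_{T→∞} (1/T) log Q_{ψ,T}(f,φ,ε)`, the limit as `ε → 0⁺`
being realized as a `limsup` along `𝓝[>] 0` (since `ε ↦ limsup_T …` is monotone,
this coincides with the limit). -/
noncomputable def inducedPressure (f : X → X) (ψ φ : X → ℝ) : EReal :=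
  limsup (fun ε : ℝ =>
    limsup (fun T : ℝ => ENNReal.log (inducedQ f ψ φ T ε) * ((T⁻¹ : ℝ) : EReal)) atTop)
    (𝓝[>] (0 : ℝ))

/-- Topological entropy `h_top(f) = P_ψ(0)` with `ψ ≡ 1`. -/
noncomputable def topEntropy (f : X → X) : EReal :=
  inducedPressure f (fun _ => 1) (fun _ => 0)

end Metric
section Cover
variable [MetricSpace X]

/-- `α` is an open cover of `X`. -/
def IsOpenCover (α : Set (Set X)) : Prop :=
  (∀ A ∈ α, IsOpen A) ∧ ⋃₀ α = univ

/-- The dynamical refinement `⋁_{i=0}^{n-1} f^{-i} α`: sets of the form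
`A_0 ∩ f^{-1}A_1 ∩ ⋯ ∩ f^{-(n-1)}A_{n-1}` with `A_i ∈ α`. -/
def dynRefine (f : X → X) (α : Set (Set X)) (n : ℕ) : Set (Set X) :=
  {B | ∃ A : ℕ → Set X, (∀ i < n, A i ∈ α) ∧ B = ⋂ i ∈ Finset.range n, f^[i] ⁻¹' A i}

/-- `q_{ψ,T}(f,φ,α)`: infimum over finite subfamilies `β_n ⊆ ⋁_{i<n} f^{-i}α` covering `X_n`
(`n ∈ S_T`) of `∑_{n ∈ S_T} ∑_{B ∈ β_n} inf_{x ∈ B} e^{S_nφ(x)}`. -/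
noncomputable def inducedq (f : X → X) (ψ φ : X → ℝ) (T : ℝ) (α : Set (Set X)) : ℝ≥0∞ :=
  ⨅ (β : ℕ → Finset (Set X)) (_ : ∀ n ∈ inducedST f ψ T,
      ((β n : Set (Set X)) ⊆ dynRefine f α n ∧ inducedXn f ψ T n ⊆ ⋃₀ (β n : Set (Set X)))),
    ∑' n : inducedST f ψ T, ∑ B ∈ β n, ⨅ x ∈ B, ENNReal.ofReal (Real.exp (birkhoff f φ n x))

/-- `p_{ψ,T}(f,φ,α)`: infimum over finite subfamilies `β_n ⊆ ⋁_{i<n} f^{-i}α` covering `X_n`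
(`n ∈ S_T`) of `∑_{n ∈ S_T} ∑_{B ∈ β_n} sup_{x ∈ B} e^{S_nφ(x)}`. -/
noncomputable def inducedp (f : X → X) (ψ φ : X → ℝ) (T : ℝ) (α : Set (Set X)) : ℝ≥0∞ :=
  ⨅ (β : ℕ → Finset (Set X)) (_ : ∀ n ∈ inducedST f ψ T,
      ((β n : Set (Set X)) ⊆ dynRefine f α n ∧ inducedXn f ψ T n ⊆ ⋃₀ (β n : Set (Set X)))),
    ∑' n : inducedST f ψ T, ∑ B ∈ β n, ⨆ x ∈ B, ENNReal.ofReal (Real.exp (birkhoff f φ n x))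

end Cover

section Stmt2
variable [MetricSpace X]

/-- `limsup_{T→∞} (1/T) log p_{ψ,T}(f,φ,α)`. -/
noncomputable def coverPressureP (f : X → X) (ψ φ : X → ℝ) (α : Set (Set X)) : EReal :=
  limsup (fun T : ℝ => ENNReal.log (inducedp f ψ φ T α) * ((T⁻¹ : ℝ) : EReal)) atTop

/-- `limsup_{T→∞} (1/T) log q_{ψ,T}(f,φ,α)`. -/
noncomputable def coverPressureQ (f : X → X) (ψ φ : X → ℝ) (α : Set (Set X)) : EReal :=
  limsup (fun T : ℝ => ENNReal.log (inducedq f ψ φ T α) * ((T⁻¹ : ℝ) : EReal)) atTop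

end Stmt2

theorem ENNReal.sum_image_le_sum {ι κ : Type*} [DecidableEq κ] {s : Finset ι} {g : ι → κ}
    {w : κ → ℝ≥0∞} {v : ι → ℝ≥0∞} (h : ∀ a ∈ s, w (g a) ≤ v a) :
    ∑ b ∈ s.image g, w b ≤ ∑ a ∈ s, v a :=
  (Finset.sum_image_le_of_nonneg fun _ _ => zero_le).trans (Finset.sum_le_sum h)

theorem EReal.limsup_add_real_le {ι : Type*} {l : Filter ι} [l.NeBot] (u : ι → EReal) (c : ℝ) :
    limsup (fun i => u i + (c : EReal)) l ≤ limsup u l + (c : EReal) := by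
  have h := EReal.limsup_add_le (u := u) (v := fun _ => (c : EReal)) (f := l)
    (by simp [limsup_const]) (by simp [limsup_const])
  rwa [limsup_const] at h

theorem limsup_log_mul_inv_le_add {a b : ℝ → ℝ≥0∞} {η : ℝ}
    (h : ∀ᶠ T in atTop, a T ≤ ENNReal.ofReal (Real.exp (T * η)) * b T) :
    limsup (fun T : ℝ => ENNReal.log (a T) * ((T⁻¹ : ℝ) : EReal)) atTop ≤
      limsup (fun T : ℝ => ENNReal.log (b T) * ((T⁻¹ : ℝ) : EReal)) atTop + (η : EReal) := by
  refine le_trans (limsup_le_limsup ?_) (EReal.limsup_add_real_le _ η)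
  filter_upwards [h, eventually_gt_atTop 0] with T hT hT0
  have hinv : (0 : EReal) ≤ ((T⁻¹ : ℝ) : EReal) := by exact_mod_cast (inv_pos.2 hT0).le
  calc ENNReal.log (a T) * ((T⁻¹ : ℝ) : EReal)
      ≤ ENNReal.log (ENNReal.ofReal (Real.exp (T * η)) * b T) * ((T⁻¹ : ℝ) : EReal) :=
        mul_le_mul_of_nonneg_right (ENNReal.log_le_log hT) hinv
    _ = ENNReal.log (b T) * ((T⁻¹ : ℝ) : EReal) + (η : EReal) := by
        rw [ENNReal.log_mul_add, ENNReal.log_ofReal_of_pos (Real.exp_pos _), Real.log_exp,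
          EReal.right_distrib_of_nonneg_of_ne_top hinv (EReal.coe_ne_top _), add_comm,
          ← EReal.coe_mul, mul_assoc, mul_comm η, ← mul_assoc, mul_inv_cancel₀ hT0.ne', one_mul]

theorem limsup_log_mul_inv_mono {a b : ℝ → ℝ≥0∞} (h : ∀ T, a T ≤ b T) :
    limsup (fun T : ℝ => ENNReal.log (a T) * ((T⁻¹ : ℝ) : EReal)) atTop ≤
      limsup (fun T : ℝ => ENNReal.log (b T) * ((T⁻¹ : ℝ) : EReal)) atTop := by
  have := limsup_log_mul_inv_le_add (a := a) (b := b) (η := 0) (by simp [h])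
  simpa using this

theorem EReal.tendsto_of_forall_pos_le_add {ι : Type*} {l : Filter ι} {u g : ι → EReal} {p : EReal}
    (hu : Tendsto u l (𝓝 p)) (hlow : ∀ η : ℝ, 0 < η → ∀ᶠ i in l, u i ≤ g i + (η : EReal))
    (hup : ∀ η : ℝ, 0 < η → ∀ᶠ i in l, g i ≤ p + (η : EReal)) : Tendsto g l (𝓝 p) := by
  refine tendsto_order.2 ⟨fun a ha => ?_, fun b hb => ?_⟩
  · obtain ⟨r, har, hrp⟩ := EReal.lt_iff_exists_real_btwn.1 ha
    obtain ⟨s, hrs, hsp⟩ := EReal.lt_iff_exists_real_btwn.1 hrp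
    have hrs' : r < s := by exact_mod_cast hrs
    filter_upwards [hlow (s - r) (_root_.sub_pos.2 hrs'), hu.eventually_const_lt hsp] with i hi hsi
    by_contra hcon
    have hle : g i + ((s - r : ℝ) : EReal) ≤ (r : EReal) + ((s - r : ℝ) : EReal) :=
      add_le_add_left ((not_lt.1 hcon).trans har.le) _
    rw [← EReal.coe_add, add_sub_cancel] at hle
    exact absurd (hsi.trans_le (hi.trans hle)) (lt_irrefl _)
  · obtain ⟨r, hpr, hrb⟩ := EReal.lt_iff_exists_real_btwn.1 hb
    obtain ⟨s, hrs, hsb⟩ := EReal.lt_iff_exists_real_btwn.1 hrb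
    have hrs' : r < s := by exact_mod_cast hrs
    filter_upwards [hup (s - r) (_root_.sub_pos.2 hrs')] with i hi
    have hle : p + ((s - r : ℝ) : EReal) ≤ (r : EReal) + ((s - r : ℝ) : EReal) :=
      add_le_add_left hpr.le _
    rw [← EReal.coe_add, add_sub_cancel] at hle
    exact (hi.trans hle).trans_lt hsb

theorem nat_mul_le_birkhoff {f : X → X} {ψ : X → ℝ} {m : ℝ} (hψm : ∀ x, m ≤ ψ x) (n : ℕ) (x : X) :
    n * m ≤ birkhoff f ψ n x := by
  simpa [birkhoff] using
    Finset.card_nsmul_le_sum (Finset.range n) (fun i => ψ (f^[i] x)) m fun i _ => hψm _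

theorem birkhoff_le_add_of_forall_le {f : X → X} {φ : X → ℝ} {τ : ℝ} {n : ℕ} {x y : X}
    (h : ∀ i < n, φ (f^[i] x) ≤ φ (f^[i] y) + τ) :
    birkhoff f φ n x ≤ birkhoff f φ n y + n * τ := by
  have := Finset.sum_le_sum fun i hi => h i (Finset.mem_range.1 hi)
  simpa [birkhoff, Finset.sum_add_distrib] using this

/-- If `φ` oscillates by at most `η * m` on the elements of `α`, then `inducedp` exceeds
`inducedq` at most by the factor `exp (T * η)`. -/
theorem inducedp_le_mul_inducedq {f : X → X} {φ ψ : X → ℝ} {α : Set (Set X)}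
    {m η : ℝ} (hη : 0 ≤ η) (hψm : ∀ x, m ≤ ψ x)
    (hα : ∀ A ∈ α, ∀ x ∈ A, ∀ y ∈ A, φ x ≤ φ y + η * m) (T : ℝ) :
    inducedp f ψ φ T α ≤ ENNReal.ofReal (Real.exp (T * η)) * inducedq f ψ φ T α := by
  have hc0 : ENNReal.ofReal (Real.exp (T * η)) ≠ 0 := by simp [Real.exp_pos]
  have hct : ENNReal.ofReal (Real.exp (T * η)) ≠ ∞ := ENNReal.ofReal_ne_top
  rw [← ENNReal.div_le_iff' hc0 hct]
  refine le_iInf₂ fun β hβ => ?_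
  rw [ENNReal.div_le_iff' hc0 hct]
  refine (iInf₂_le β hβ).trans ?_
  rw [← ENNReal.tsum_mul_left]
  refine ENNReal.tsum_le_tsum fun ⟨n, hn⟩ => ?_
  rw [Finset.mul_sum]
  refine Finset.sum_le_sum fun B hB => ?_
  rw [← ENNReal.div_le_iff' hc0 hct]
  refine le_iInf₂ fun y hy => ?_
  rw [ENNReal.div_le_iff' hc0 hct]
  refine iSup₂_le fun x hx => ?_
  rw [← ENNReal.ofReal_mul (Real.exp_pos _).le, ← Real.exp_add]
  refine ENNReal.ofReal_le_ofReal (Real.exp_le_exp.2 ?_)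
  obtain ⟨A, hA, rfl⟩ := (hβ n hn).1 hB
  simp only [mem_iInter, Finset.mem_range, mem_preimage] at hx hy
  have hxy := birkhoff_le_add_of_forall_le fun i hi =>
    hα _ (hA i hi) _ (hx i hi) _ (hy i hi)
  obtain ⟨z, hz, -⟩ := hn
  have hnT : n * m ≤ T := (nat_mul_le_birkhoff hψm n z).trans hz
  nlinarith [mul_le_mul_of_nonneg_right hnT hη]

section Comparison

variable [MetricSpace X] {f : X → X} {φ ψ : X → ℝ} {α : Set (Set X)}

theorem dist_iterate_le_of_mem_dynRefine {δ : ℝ} {n : ℕ} {B : Set X}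
    (hα : ∀ A ∈ α, ∀ x ∈ A, ∀ y ∈ A, dist x y ≤ δ) (hB : B ∈ dynRefine f α n)
    {x y : X} (hx : x ∈ B) (hy : y ∈ B) {i : ℕ} (hi : i < n) :
    dist (f^[i] x) (f^[i] y) ≤ δ := by
  obtain ⟨A, hA, rfl⟩ := hB
  simp only [mem_iInter, Finset.mem_range, mem_preimage] at hx hy
  exact hα _ (hA i hi) _ (hx i hi) _ (hy i hi)

theorem inducedQ_antitone (f : X → X) (ψ φ : X → ℝ) (T : ℝ) :
    Antitone fun ε => inducedQ f ψ φ T ε := by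
  intro ε₁ ε₂ hε
  refine le_iInf₂ fun F hF => iInf₂_le F fun n hn y hy => ?_
  obtain ⟨x, hx, hxy⟩ := hF n hn y hy
  exact ⟨x, hx, fun i hi => (hxy i hi).trans hε⟩

/-- If `ε` is below a Lebesgue number of `α`, the refined cover elements around the points of a
spanning set form a cover. -/
theorem inducedq_le_inducedQ {ε : ℝ} (hε : 0 ≤ ε)
    (hα : ∀ x, ∃ A ∈ α, Metric.closedBall x ε ⊆ A) (T : ℝ) :
    inducedq f ψ φ T α ≤ inducedQ f ψ φ T ε := by
  classical
  choose A hAα hA using hα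
  let C : ℕ → X → Set X := fun n x => ⋂ i ∈ Finset.range n, f^[i] ⁻¹' A (f^[i] x)
  have hC : ∀ n x, x ∈ C n x := fun n x => by
    simp only [C, mem_iInter, mem_preimage]
    exact fun i _ => hA _ (Metric.mem_closedBall_self hε)
  refine le_iInf₂ fun F hF => iInf₂_le_of_le (fun n => (F n).image (C n)) ?_ ?_
  · intro n hn
    refine ⟨?_, fun y hy => ?_⟩
    · intro B hB
      obtain ⟨x, -, rfl⟩ := Finset.mem_image.1 (Finset.mem_coe.1 hB)
      exact ⟨fun i => A (f^[i] x), fun i _ => hAα _, rfl⟩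
    · obtain ⟨x, hx, hxy⟩ := hF n hn y hy
      refine ⟨C n x, Finset.mem_coe.2 (Finset.mem_image_of_mem _ hx), ?_⟩
      simp only [C, mem_iInter, mem_preimage, Finset.mem_range]
      exact fun i hi => hA _ (by simpa [dist_comm] using hxy i hi)
  · exact ENNReal.tsum_le_tsum fun n => ENNReal.sum_image_le_sum fun x _ => iInf₂_le x (hC n x)

theorem inducedQ_le_inducedp {δ : ℝ} (hα : ∀ A ∈ α, ∀ x ∈ A, ∀ y ∈ A, dist x y ≤ δ) (T : ℝ) :
    inducedQ f ψ φ T δ ≤ inducedp f ψ φ T α := by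
  classical
  rcases isEmpty_or_nonempty X with hX | hX
  · exact iInf₂_le_of_le (fun _ => ∅) (fun _ _ y => isEmptyElim y) (by simp)
  have hpt : ∀ B : Set X, ∃ x, B.Nonempty → x ∈ B := fun B => by
    by_cases hB : B.Nonempty
    · exact ⟨hB.some, fun _ => hB.some_mem⟩
    · exact ⟨hX.some, fun h => absurd h hB⟩
  choose pt hpt using hpt
  refine le_iInf₂ fun β hβ =>
    iInf₂_le_of_le (fun n => ((β n).filter Set.Nonempty).image pt) ?_ ?_
  · intro n hn y hy
    obtain ⟨B, hB, hyB⟩ := (hβ n hn).2 hy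
    have hne : B.Nonempty := ⟨y, hyB⟩
    exact ⟨pt B, Finset.mem_image_of_mem _ (Finset.mem_filter.2 ⟨hB, hne⟩),
      fun i hi => dist_iterate_le_of_mem_dynRefine hα ((hβ n hn).1 hB) (hpt B hne) hyB hi⟩
  · refine ENNReal.tsum_le_tsum fun n => ?_
    refine (ENNReal.sum_image_le_sum (v := fun B => ⨆ x ∈ B,
      ENNReal.ofReal (Real.exp (birkhoff f φ n x))) fun B hB => ?_).trans
        (Finset.sum_le_sum_of_subset (Finset.filter_subset _ _))
    exact le_iSup₂ (f := fun x (_ : x ∈ B) => ENNReal.ofReal (Real.exp (birkhoff f φ n x)))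
      (pt B) (hpt B (Finset.mem_filter.1 hB).2)

theorem inducedPressure_tendsto (f : X → X) (ψ φ : X → ℝ) :
    Tendsto (fun ε : ℝ => limsup (fun T : ℝ =>
      ENNReal.log (inducedQ f ψ φ T ε) * ((T⁻¹ : ℝ) : EReal)) atTop)
      (𝓝[>] (0 : ℝ)) (𝓝 (inducedPressure f ψ φ)) := by
  have hanti : Antitone fun ε : ℝ => limsup (fun T : ℝ =>
      ENNReal.log (inducedQ f ψ φ T ε) * ((T⁻¹ : ℝ) : EReal)) atTop :=
    fun _ _ h => limsup_log_mul_inv_mono fun T => inducedQ_antitone f ψ φ T h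
  have ht := hanti.tendsto_nhdsGT 0
  rwa [← ht.limsup_eq] at ht

theorem coverPressureQ_le_inducedPressure [CompactSpace X] (hα : IsOpenCover α) :
    coverPressureQ f ψ φ α ≤ inducedPressure f ψ φ := by
  obtain ⟨δ, hδ, hball⟩ := lebesgue_number_lemma_of_metric_sUnion isCompact_univ hα.1 hα.2.ge
  refine ge_of_tendsto (inducedPressure_tendsto f ψ φ) ?_
  filter_upwards [Ioo_mem_nhdsGT hδ] with ε hε
  refine limsup_log_mul_inv_mono fun T => inducedq_le_inducedQ hε.1.le (fun x => ?_) T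
  obtain ⟨A, hA, hsub⟩ := hball x (mem_univ x)
  exact ⟨A, hA, (Metric.closedBall_subset_ball hε.2).trans hsub⟩

theorem exists_isOpenCover_diam_le (X : Type*) [MetricSpace X] {δ : ℝ} (hδ : 0 < δ) :
    ∃ α : Set (Set X), IsOpenCover α ∧ ∀ A ∈ α, Metric.ediam A ≤ ENNReal.ofReal δ := by
  refine ⟨range fun x => Metric.ball x (δ / 2), ⟨?_, ?_⟩, ?_⟩
  · rintro _ ⟨x, rfl⟩
    exact Metric.isOpen_ball
  · exact eq_univ_of_forall fun x => ⟨_, ⟨x, rfl⟩, Metric.mem_ball_self (half_pos hδ)⟩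
  · rintro _ ⟨x, rfl⟩
    refine Metric.ediam_le fun y hy z hz => ?_
    rw [edist_dist]
    refine ENNReal.ofReal_le_ofReal ?_
    linarith [dist_triangle_right y z x, Metric.mem_ball.1 hy, Metric.mem_ball.1 hz]

theorem dist_le_of_ediam_le {δ : ℝ} (hδ : 0 ≤ δ) {A : Set X}
    (hA : Metric.ediam A ≤ ENNReal.ofReal δ) : ∀ x ∈ A, ∀ y ∈ A, dist x y ≤ δ :=
  fun _ hx _ hy => (edist_le_ofReal hδ).1 ((Metric.edist_le_ediam_of_mem hx hy).trans hA)

theorem eventually_coverPressureP_le_add [CompactSpace X] (f : X → X) (hφ : Continuous φ)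
    {m : ℝ} (hm : 0 < m) (hψm : ∀ x, m ≤ ψ x) {η : ℝ} (hη : 0 < η) :
    ∀ᶠ δ in 𝓝[>] (0 : ℝ), ∀ α : Set (Set X),
      (∀ A ∈ α, Metric.ediam A ≤ ENNReal.ofReal δ) →
        coverPressureP f ψ φ α ≤ coverPressureQ f ψ φ α + (η : EReal) := by
  obtain ⟨r, hr, hφr⟩ := Metric.uniformContinuous_iff.1
    (CompactSpace.uniformContinuous_of_continuous hφ) (η * m) (mul_pos hη hm)
  filter_upwards [Ioo_mem_nhdsGT hr] with δ hδ α hα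
  refine limsup_log_mul_inv_le_add (Eventually.of_forall
    (inducedp_le_mul_inducedq hη.le hψm fun A hA x hx y hy => ?_))
  have h := hφr ((dist_le_of_ediam_le hδ.1.le (hα A hA) x hx y hy).trans_lt hδ.2)
  rw [Real.dist_eq] at h
  linarith [le_abs_self (φ x - φ y)]

end Comparison


/-- For `φ, ψ ∈ C(X,ℝ)` with `0 < m ≤ ψ ≤ M`, each of the following
equals the induced pressure `P_ψ(φ)`:
(i) `lim_{δ→0} sup_α limsup_{T→∞} (1/T) log p_{ψ,T}(f,φ,α)` over open covers `α` with
`diam(α) ≤ δ`; (ii) the same with `q_{ψ,T}`; (iii) `sup_α limsup_{T→∞} (1/T) log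
q_{ψ,T}(f,φ,α)` over all open covers `α`. -/
theorem inducedPressure_eq_coverPressures
    {X : Type*} [MetricSpace X] [CompactSpace X]
    (f : X → X) (hf : Continuous f)
    (φ ψ : X → ℝ) (hφ : Continuous φ) (hψ : Continuous ψ)
    (m M : ℝ) (hm : 0 < m) (hψm : ∀ x, m ≤ ψ x) (hψM : ∀ x, ψ x ≤ M) :
    Tendsto (fun δ : ℝ =>
        ⨆ (α : Set (Set X)) (_ : IsOpenCover α ∧
            ∀ A ∈ α, EMetric.diam A ≤ ENNReal.ofReal δ),
          coverPressureP f ψ φ α) (𝓝[>] (0 : ℝ)) (𝓝 (inducedPressure f ψ φ)) ∧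
    Tendsto (fun δ : ℝ =>
        ⨆ (α : Set (Set X)) (_ : IsOpenCover α ∧
            ∀ A ∈ α, EMetric.diam A ≤ ENNReal.ofReal δ),
          coverPressureQ f ψ φ α) (𝓝[>] (0 : ℝ)) (𝓝 (inducedPressure f ψ φ)) ∧
    (⨆ (α : Set (Set X)) (_ : IsOpenCover α), coverPressureQ f ψ φ α) =
      inducedPressure f ψ φ := by
  have hQ := inducedPressure_tendsto f ψ φ
  have hlow : ∀ δ > 0, ∀ α : Set (Set X), (∀ A ∈ α, Metric.ediam A ≤ ENNReal.ofReal δ) →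
      limsup (fun T : ℝ => ENNReal.log (inducedQ f ψ φ T δ) * ((T⁻¹ : ℝ) : EReal)) atTop ≤
        coverPressureP f ψ φ α := fun δ hδ α hα =>
    limsup_log_mul_inv_mono
      (inducedQ_le_inducedp fun A hA => dist_le_of_ediam_le (le_of_lt hδ) (hα A hA))
  have hpq : ∀ η : ℝ, 0 < η → _ := fun η hη => eventually_coverPressureP_le_add f hφ hm hψm hη
  have hTq : Tendsto (fun δ : ℝ =>
      ⨆ (α : Set (Set X)) (_ : IsOpenCover α ∧ ∀ A ∈ α, EMetric.diam A ≤ ENNReal.ofReal δ),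
        coverPressureQ f ψ φ α) (𝓝[>] (0 : ℝ)) (𝓝 (inducedPressure f ψ φ)) := by
    refine EReal.tendsto_of_forall_pos_le_add hQ (fun η hη => ?_) (fun η hη => ?_)
    · filter_upwards [hpq η hη, self_mem_nhdsWithin] with δ hδ hδ0
      obtain ⟨α, hα, hαδ⟩ := exists_isOpenCover_diam_le X hδ0
      exact ((hlow δ hδ0 α hαδ).trans (hδ α hαδ)).trans
        (add_le_add_left (le_iSup₂ (f := fun α _ => coverPressureQ f ψ φ α) α ⟨hα, hαδ⟩) _)
    · exact Eventually.of_forall fun δ => iSup₂_le fun α hα =>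
        (coverPressureQ_le_inducedPressure hα.1).trans
          (le_add_of_nonneg_right (by exact_mod_cast hη.le))
  refine ⟨EReal.tendsto_of_forall_pos_le_add hQ (fun η hη => ?_) (fun η hη => ?_), hTq,
    le_antisymm (iSup₂_le fun α hα => coverPressureQ_le_inducedPressure hα) ?_⟩
  · filter_upwards [self_mem_nhdsWithin] with δ hδ0
    obtain ⟨α, hα, hαδ⟩ := exists_isOpenCover_diam_le X hδ0
    exact ((hlow δ hδ0 α hαδ).trans
      (le_iSup₂ (f := fun α _ => coverPressureP f ψ φ α) α ⟨hα, hαδ⟩)).trans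
        (le_add_of_nonneg_right (by exact_mod_cast hη.le))
  · filter_upwards [hpq η hη] with δ hδ
    exact iSup₂_le fun α hα => (hδ α hα.2).trans
      (add_le_add_left (coverPressureQ_le_inducedPressure hα.1) _)
  · exact le_of_tendsto' hTq fun δ => iSup₂_le fun α hα =>
      le_iSup₂ (f := fun α _ => coverPressureQ f ψ φ α) α hα.1
end

section
/- Let (X,d) be a compact metric space, f : X → X continuous with h_top(f) < +∞, and ψ ∈ C(X,ℝ) with ψ > 0. Let μ be a Borel probability measure on X. Then ∫φ dμ ≤ P_ψ(φ) · ∫ψ dμ holds for every φ ∈ C(X,ℝ) if and only if μ is f-invariant. -/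
open Filter Set Topology MeasureTheory ENNReal

variable {X : Type*}

section Meas
variable [MetricSpace X] [MeasurableSpace X] [BorelSpace X]

/-- Entropy of the finite measurable partition of `X` induced by a map `q` into a finite
type: `H(q) = ∑_s -μ(q⁻¹{s}) log μ(q⁻¹{s})`. -/
noncomputable def mapEntropy {S : Type*} [Fintype S] (μ : Measure X) (q : X → S) : ℝ :=
  ∑ s : S, Real.negMulLog ((μ (q ⁻¹' {s})).toReal)

/-- Kolmogorov–Sinai (measure-theoretic) entropy `h_μ(f)`: the supremum, over finite
measurable partitions (encoded as measurable maps `p : X → Fin k`), of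
`lim_n (1/n) H(⋁_{i<n} f^{-i} p)`; the limit exists by subadditivity and is
realized here as a `liminf`. -/
noncomputable def measEntropy (f : X → X) (μ : Measure X) : EReal :=
  ⨆ (k : ℕ) (p : X → Fin k) (_ : Measurable p),
    liminf (fun n : ℕ =>
      (((n : ℝ)⁻¹ * mapEntropy μ (fun x (i : Fin n) => p (f^[i] x)) : ℝ) : EReal)) atTop

/-- The set `M(X,f)` of `f`-invariant Borel probability measures on `X`. -/
def invMeasures (f : X → X) : Set (Measure X) :=
  {μ | IsProbabilityMeasure μ ∧ ∀ B : Set X, MeasurableSet B → μ (f ⁻¹' B) = μ B}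

/-- `μ` is an equilibrium state of `P_ψ(φ)`:
`μ ∈ M(X,f)` and `P_ψ(φ) = (h_μ(f) + ∫φ dμ)/(∫ψ dμ)`. -/
noncomputable def equilibriumStates (f : X → X) (ψ φ : X → ℝ) : Set (Measure X) :=
  {μ | μ ∈ invMeasures f ∧
    inducedPressure f ψ φ =
      (measEntropy f μ + ((∫ x, φ x ∂μ : ℝ) : EReal)) / (((∫ x, ψ x ∂μ : ℝ) : EReal))}

end Meas

section Birkhoff

lemma natCast_mul_le_birkhoff {f : X → X} {ψ : X → ℝ} {m : ℝ} (hm : ∀ x, m ≤ ψ x) (n : ℕ) (x : X) :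
    n * m ≤ birkhoff f ψ n x := by
  have h := Finset.card_nsmul_le_sum (Finset.range n) (fun i => ψ (f^[i] x)) m fun i _ => hm _
  simpa [birkhoff] using h

lemma birkhoff_sub (f : X → X) (φ ψ : X → ℝ) (n : ℕ) (x : X) :
    birkhoff f (fun y => φ y - ψ y) n x = birkhoff f φ n x - birkhoff f ψ n x :=
  Finset.sum_sub_distrib _ _

lemma birkhoff_const_mul (f : X → X) (c : ℝ) (ψ : X → ℝ) (n : ℕ) (x : X) :
    birkhoff f (fun y => c * ψ y) n x = c * birkhoff f ψ n x :=
  (Finset.mul_sum _ _ _).symm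

lemma birkhoff_coboundary (f : X → X) (g : X → ℝ) (n : ℕ) (x : X) :
    birkhoff f (fun y => g (f y) - g y) n x = g (f^[n] x) - g x := by
  have h := Finset.sum_range_sub (fun i => g (f^[i] x)) n
  simpa [birkhoff, Function.iterate_succ_apply'] using h

lemma integral_birkhoff [TopologicalSpace X] [CompactSpace X] [MeasurableSpace X]
    [BorelSpace X] {f : X → X} (hf : Continuous f) {μ : Measure X} [IsFiniteMeasure μ]
    (hμ : MeasurePreserving f μ μ) {φ : X → ℝ} (hφ : Continuous φ) (n : ℕ) :
    ∫ x, birkhoff f φ n x ∂μ = n * ∫ x, φ x ∂μ := by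
  have hint (i : ℕ) : Integrable (fun x => φ (f^[i] x)) μ :=
    (hφ.comp (hf.iterate i)).integrable_of_hasCompactSupport (HasCompactSupport.of_compactSpace _)
  have hi (i : ℕ) : ∫ x, φ (f^[i] x) ∂μ = ∫ x, φ x ∂μ := by
    conv_rhs => rw [← (hμ.iterate i).map_eq]
    exact (integral_map (hf.iterate i).aemeasurable hφ.aestronglyMeasurable).symm
  simp only [birkhoff]
  rw [integral_finsetSum _ fun i _ => hint i]
  simp [hi]

lemma inducedST_subset {f : X → X} {ψ : X → ℝ} {m : ℝ} (hm : 0 < m) (hψm : ∀ x, m ≤ ψ x)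
    (T : ℝ) : inducedST f ψ T ⊆ Finset.range (⌊T / m⌋₊ + 1) := by
  rintro n ⟨x, hx, -⟩
  have h : (n : ℝ) ≤ T / m := (le_div_iff₀ hm).2 ((natCast_mul_le_birkhoff hψm n x).trans hx)
  simpa [Nat.lt_succ_iff] using Nat.le_floor h

end Birkhoff

section Pressure
variable [MetricSpace X]

/-- A point of `X_n` bounds `Q_{ψ,T}` from below, up to the oscillation of `φ` at scale `ε`. -/
lemma le_inducedQ {f : X → X} {ψ φ : X → ℝ} {T ε η : ℝ} {n : ℕ} {x : X}
    (hx : x ∈ inducedXn f ψ T n)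
    (hη : ∀ y z, dist y z ≤ ε → φ z - η ≤ φ y) :
    ENNReal.ofReal (Real.exp (birkhoff f φ n x - n * η)) ≤ inducedQ f ψ φ T ε := by
  refine le_iInf₂ fun F hF => ?_
  have hn : n ∈ inducedST f ψ T := ⟨x, hx⟩
  obtain ⟨y, hy, hd⟩ := hF n hn x hx
  have hle : birkhoff f φ n x - n * η ≤ birkhoff f φ n y := by
    have h := Finset.sum_le_sum fun i (hi : i ∈ Finset.range n) =>
      hη _ _ (hd i (Finset.mem_range.1 hi))
    simpa [birkhoff, Finset.sum_sub_distrib] using h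
  calc ENNReal.ofReal (Real.exp (birkhoff f φ n x - n * η))
      ≤ ENNReal.ofReal (Real.exp (birkhoff f φ n y)) := by gcongr
    _ ≤ ∑ z ∈ F n, ENNReal.ofReal (Real.exp (birkhoff f φ n z)) :=
        Finset.single_le_sum (f := fun z => ENNReal.ofReal (Real.exp (birkhoff f φ n z)))
          (fun _ _ => zero_le) hy
    _ ≤ _ := ENNReal.le_tsum (f := fun k : inducedST f ψ T =>
        ∑ z ∈ F k, ENNReal.ofReal (Real.exp (birkhoff f φ k z))) ⟨n, hn⟩

lemma log_ofReal_exp (a : ℝ) : ENNReal.log (ENNReal.ofReal (Real.exp a)) = a := by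
  rw [ENNReal.log_ofReal_of_pos (Real.exp_pos a), Real.log_exp]

lemma le_log_mul_inv {q : ℝ≥0∞} {a T : ℝ} (hT : 0 < T)
    (h : ENNReal.ofReal (Real.exp (a * T)) ≤ q) :
    (a : EReal) ≤ ENNReal.log q * ((T⁻¹ : ℝ) : EReal) := by
  have h1 : ((a * T : ℝ) : EReal) ≤ ENNReal.log q := by
    rw [← log_ofReal_exp]
    exact ENNReal.log_monotone h
  calc (a : EReal) = ((a * T : ℝ) : EReal) * ((T⁻¹ : ℝ) : EReal) := by
        rw [← EReal.coe_mul, mul_inv_cancel_right₀ hT.ne']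
    _ ≤ _ := mul_le_mul_of_nonneg_right h1 (by exact_mod_cast (inv_pos.2 hT).le)

lemma log_mul_inv_le {q : ℝ≥0∞} {a T : ℝ} (hT : 0 < T)
    (h : q ≤ ENNReal.ofReal (Real.exp (a * T))) :
    ENNReal.log q * ((T⁻¹ : ℝ) : EReal) ≤ a := by
  have h1 : ENNReal.log q ≤ ((a * T : ℝ) : EReal) := by
    rw [← log_ofReal_exp]
    exact ENNReal.log_monotone h
  calc ENNReal.log q * ((T⁻¹ : ℝ) : EReal)
      ≤ ((a * T : ℝ) : EReal) * ((T⁻¹ : ℝ) : EReal) :=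
        mul_le_mul_of_nonneg_right h1 (by exact_mod_cast (inv_pos.2 hT).le)
    _ = a := by rw [← EReal.coe_mul, mul_inv_cancel_right₀ hT.ne']

/-- If every `n` admits a point with `S_nφ ≥ c S_nψ`, then `P_ψ(φ) ≥ c`. -/
lemma le_inducedPressure [CompactSpace X] {f : X → X} {ψ φ : X → ℝ} (hφ : Continuous φ)
    {m : ℝ} (hm : 0 < m) (hψm : ∀ x, m ≤ ψ x) {c : ℝ}
    (hc : ∀ n, ∃ x, c * birkhoff f ψ n x ≤ birkhoff f φ n x) :
    (c : EReal) ≤ inducedPressure f ψ φ := by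
  choose x hx using hc
  refine EReal.ge_of_forall_gt_iff_ge.1 fun b hb => ?_
  have hbc : b < c := by exact_mod_cast hb
  set δ := c - b with hδ
  have hδ0 : 0 < δ := sub_pos.2 hbc
  obtain ⟨r, hr, hunif⟩ := Metric.uniformContinuous_iff.1
    (CompactSpace.uniformContinuous_of_continuous hφ) (δ * m) (by positivity)
  refine le_limsup_of_frequently_le' (Eventually.frequently ?_)
  filter_upwards [Ioo_mem_nhdsGT hr] with ε hε
  have htend : Tendsto (fun n : ℕ => birkhoff f ψ n (x n)) atTop atTop :=
    tendsto_atTop_mono (fun n => natCast_mul_le_birkhoff hψm n (x n))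
      (tendsto_natCast_atTop_atTop.atTop_mul_const hm)
  refine le_limsup_of_frequently_le' (htend.frequently (Eventually.frequently ?_))
  filter_upwards [htend.eventually_gt_atTop 0] with n hn
  refine le_log_mul_inv hn (le_trans ?_ (le_inducedQ (n := n) (x := x n) (η := δ * m)
    ⟨le_rfl, ?_⟩ fun y z hyz => ?_))
  · refine ENNReal.ofReal_le_ofReal (Real.exp_le_exp.2 ?_)
    have h1 := mul_le_mul_of_nonneg_left (natCast_mul_le_birkhoff (f := f) hψm n (x n)) hδ0.le
    have h2 : b = c - δ := by rw [hδ]; ring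
    rw [h2]
    linarith [hx n]
  · have h1 := hψm (f^[n] (x n))
    simp only [birkhoff, Finset.sum_range_succ]
    linarith
  · have h := hunif (lt_of_le_of_lt hyz hε.2)
    rw [Real.dist_eq, abs_lt] at h
    linarith

/-- Finite topological entropy gives exponential bounds on cardinalities of spanning sets. -/
lemma exists_spanning_card_le [Nonempty X] {f : X → X} (htop : topEntropy f < ⊤) :
    ∃ C : ℝ, 0 ≤ C ∧ ∀ᶠ ε in 𝓝[>] (0 : ℝ), ∀ᶠ N : ℕ in atTop,
      ∃ F : Finset X, IsSpanningSetOf f N ε univ F ∧ (F.card : ℝ) ≤ Real.exp (C * N) := by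
  obtain ⟨C, hC, -⟩ := EReal.lt_iff_exists_real_btwn.1 htop
  refine ⟨max C 0 + 1, by positivity, ?_⟩
  filter_upwards [eventually_lt_of_limsup_lt hC] with ε hε
  filter_upwards [tendsto_natCast_atTop_atTop.eventually (eventually_lt_of_limsup_lt hε),
    eventually_gt_atTop 0] with N hN hN0
  have hN0' : (0 : ℝ) < N := by exact_mod_cast hN0
  have hQ : inducedQ f (fun _ => 1) (fun _ => 0) N ε
      < ENNReal.ofReal (Real.exp ((max C 0 + 1) * N)) := by
    by_contra! h
    have h1 := (le_log_mul_inv hN0' h).trans hN.le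
    have h2 : max C 0 + 1 ≤ C := by exact_mod_cast h1
    linarith [le_max_left C 0]
  obtain ⟨F, hF⟩ := iInf_lt_iff.1 hQ
  obtain ⟨hspan, hsum⟩ := iInf_lt_iff.1 hF
  have hmem (y : X) : y ∈ inducedXn f (fun _ => 1) (N : ℝ) N := by
    simp [inducedXn, birkhoff]
  have hST : N ∈ inducedST f (fun _ : X => 1) (N : ℝ) :=
    ⟨Classical.arbitrary X, hmem _⟩
  refine ⟨F N, fun y _ => hspan N hST y (hmem y), ?_⟩
  have hle := (ENNReal.le_tsum (f := fun k : inducedST f (fun _ : X => 1) (N : ℝ) =>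
    ∑ z ∈ F k, ENNReal.ofReal (Real.exp (birkhoff f (fun _ => 0) k z))) ⟨N, hST⟩).trans hsum.le
  have hcard : ((F N).card : ℝ≥0∞) ≤ ENNReal.ofReal (Real.exp ((max C 0 + 1) * N)) := by
    simpa [birkhoff] using hle
  rw [← ENNReal.ofReal_natCast] at hcard
  exact (ENNReal.ofReal_le_ofReal_iff (Real.exp_pos _).le).1 hcard

lemma inducedQ_le_of_spanning {f : X → X} {ψ φ : X → ℝ} {m : ℝ} (hm : 0 < m)
    (hψm : ∀ x, m ≤ ψ x) {K : ℝ} (hK : ∀ n x, birkhoff f φ n x ≤ K) {T ε : ℝ} {F : Finset X}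
    (hF : IsSpanningSetOf f ⌊T / m⌋₊ ε univ F) :
    inducedQ f ψ φ T ε ≤
      ENNReal.ofReal ((⌊T / m⌋₊ + 1 : ℝ) * (F.card * Real.exp K)) := by
  have hsub := inducedST_subset (f := f) hm hψm T
  refine (iInf₂_le (fun _ => F) fun n hn y _ => ?_).trans ?_
  · obtain ⟨x, hx, hd⟩ := hF y (mem_univ y)
    have hn' := Finset.mem_range.1 (Finset.mem_coe.1 (hsub hn))
    exact ⟨x, hx, fun i hi => hd i (by omega)⟩
  · have hterm (n : ℕ) : ∑ x ∈ F, ENNReal.ofReal (Real.exp (birkhoff f φ n x))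
        ≤ ENNReal.ofReal (F.card * Real.exp K) := by
      rw [← ENNReal.ofReal_sum_of_nonneg fun _ _ => (Real.exp_pos _).le]
      refine ENNReal.ofReal_le_ofReal ?_
      simpa using Finset.sum_le_card_nsmul F (fun x => Real.exp (birkhoff f φ n x)) (Real.exp K)
        fun x _ => Real.exp_le_exp.2 (hK n x)
    calc ∑' n : inducedST f ψ T, ∑ x ∈ F, ENNReal.ofReal (Real.exp (birkhoff f φ n x))
        ≤ ∑' _ : inducedST f ψ T, ENNReal.ofReal (F.card * Real.exp K) :=
          ENNReal.tsum_le_tsum fun n => hterm n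
      _ ≤ ∑' _ : (Finset.range (⌊T / m⌋₊ + 1) : Set ℕ), ENNReal.ofReal (F.card * Real.exp K) :=
          ENNReal.tsum_mono_subtype (fun _ => ENNReal.ofReal (F.card * Real.exp K)) hsub
      _ = ENNReal.ofReal ((⌊T / m⌋₊ + 1 : ℝ) * (F.card * Real.exp K)) := by
          rw [Finset.tsum_subtype' (Finset.range (⌊T / m⌋₊ + 1))
            fun _ => ENNReal.ofReal (F.card * Real.exp K)]
          rw [ENNReal.ofReal_mul (p := (⌊T / m⌋₊ + 1 : ℝ)) (by positivity), ← Nat.cast_succ,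
            ENNReal.ofReal_natCast]
          simp only [Finset.sum_const, Finset.card_range, nsmul_eq_mul]

/-- When `h_top(f) < ∞`, the pressure of all potentials with Birkhoff sums bounded above is
bounded by a single constant. -/
lemma exists_forall_inducedPressure_le [Nonempty X] {f : X → X} (htop : topEntropy f < ⊤)
    {ψ : X → ℝ} {m : ℝ} (hm : 0 < m) (hψm : ∀ x, m ≤ ψ x) :
    ∃ D : ℝ, ∀ (φ : X → ℝ) (K : ℝ), (∀ n x, birkhoff f φ n x ≤ K) →
      inducedPressure f ψ φ ≤ D := by
  obtain ⟨C, hC0, hC⟩ := exists_spanning_card_le htop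
  refine ⟨C / m + 1, fun φ K hK => limsup_le_of_le (by isBoundedDefault) ?_⟩
  filter_upwards [hC] with ε hε
  refine limsup_le_of_le (by isBoundedDefault) ?_
  have hfloor : Tendsto (fun T : ℝ => ⌊T / m⌋₊) atTop atTop :=
    tendsto_nat_floor_atTop.comp (tendsto_id.atTop_div_const hm)
  have hexp : ∀ᶠ T : ℝ in atTop, (T / m + 1) * Real.exp K ≤ Real.exp T := by
    have h1 : (fun T : ℝ => (T / m + 1) * Real.exp K) =o[atTop] Real.exp := by
      have hT : (fun T : ℝ => T) =o[atTop] Real.exp := by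
        simpa using Real.isLittleO_pow_exp_atTop (n := 1)
      have h0 : (fun _ : ℝ => (1 : ℝ)) =o[atTop] Real.exp := by
        simpa using Real.isLittleO_pow_exp_atTop (n := 0)
      refine ((hT.const_mul_left (Real.exp K / m)).add (h0.const_mul_left (Real.exp K))).congr_left
        fun T => ?_
      ring
    filter_upwards [h1.bound one_pos] with T hT
    simpa using (le_abs_self _).trans hT
  filter_upwards [hfloor.eventually hε, hexp, eventually_gt_atTop 0] with T hT hTe hT0
  obtain ⟨F, hF, hcard⟩ := hT
  refine log_mul_inv_le hT0 ((inducedQ_le_of_spanning hm hψm hK hF).trans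
    (ENNReal.ofReal_le_ofReal ?_))
  have hfl : (⌊T / m⌋₊ : ℝ) ≤ T / m := Nat.floor_le (by positivity)
  calc (⌊T / m⌋₊ + 1 : ℝ) * (F.card * Real.exp K)
      ≤ (T / m + 1) * (Real.exp (C * (T / m)) * Real.exp K) := by
        gcongr
        exact hcard.trans (Real.exp_le_exp.2 (by gcongr))
    _ = (T / m + 1) * Real.exp K * Real.exp (C * (T / m)) := by ring
    _ ≤ Real.exp T * Real.exp (C * (T / m)) := by gcongr
    _ = Real.exp ((C / m + 1) * T) := by rw [← Real.exp_add]; congr 1; ring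

end Pressure

/-- Suppose `h_top(f) < ∞` and `ψ > 0` is continuous. For a Borel
probability measure `μ`, one has `∫φ dμ ≤ P_ψ(φ) ∫ψ dμ` for every continuous `φ`
if and only if `μ` is `f`-invariant. -/
theorem integral_le_pressure_iff_invariant
    {X : Type*} [MetricSpace X] [CompactSpace X] [Nonempty X]
    [MeasurableSpace X] [BorelSpace X]
    (f : X → X) (hf : Continuous f)
    (ψ : X → ℝ) (hψ : Continuous ψ) (hψpos : ∀ x, 0 < ψ x)
    (htop : topEntropy f < ⊤)
    (μ : Measure X) [IsProbabilityMeasure μ] :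
    (∀ φ : X → ℝ, Continuous φ →
        ((∫ x, φ x ∂μ : ℝ) : EReal) ≤
          inducedPressure f ψ φ * ((∫ x, ψ x ∂μ : ℝ) : EReal)) ↔
      ∀ B : Set X, MeasurableSet B → μ (f ⁻¹' B) = μ B := by
  obtain ⟨x₀, -, hx₀⟩ := isCompact_univ.exists_isMinOn univ_nonempty hψ.continuousOn
  have hm : 0 < ψ x₀ := hψpos x₀
  have hψm (x : X) : ψ x₀ ≤ ψ x := hx₀ (mem_univ x)
  have hint {φ : X → ℝ} (hφ : Continuous φ) : Integrable φ μ :=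
    hφ.integrable_of_hasCompactSupport (HasCompactSupport.of_compactSpace _)
  have hψint : 0 < ∫ x, ψ x ∂μ := by
    have h := integral_mono (integrable_const (ψ x₀)) (hint hψ) hψm
    simp only [integral_const, probReal_univ, one_smul] at h
    exact hm.trans_le h
  constructor
  · intro H
    obtain ⟨D, hD⟩ := exists_forall_inducedPressure_le htop hm hψm
    have hcob (g : X → ℝ) (hg : Continuous g) :
        ∫ x, (g (f x) - g x) ∂μ ≤ D * ∫ x, ψ x ∂μ := by
      obtain ⟨M, hM⟩ := isCompact_univ.exists_bound_of_continuousOn hg.continuousOn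
      have hP := hD (fun x => g (f x) - g x) (M + M) fun n x => by
        rw [birkhoff_coboundary]
        have h1 := abs_le.1 (hM (f^[n] x) (mem_univ _))
        have h2 := abs_le.1 (hM x (mem_univ _))
        linarith
      have h := (H _ ((hg.comp hf).sub hg)).trans
        (mul_le_mul_of_nonneg_right hP (by exact_mod_cast hψint.le))
      exact_mod_cast h
    have hzero (g : X → ℝ) (hg : Continuous g) : ∫ x, (g (f x) - g x) ∂μ = 0 := by
      by_contra hne
      have h := hcob (fun x => ((D * ∫ x, ψ x ∂μ) + 1) / (∫ x, (g (f x) - g x) ∂μ) * g x)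
        (continuous_const.mul hg)
      simp only [← mul_sub] at h
      rw [integral_const_mul, div_mul_cancel₀ _ hne] at h
      linarith
    have hmap : μ.map f = μ := by
      have : IsProbabilityMeasure (μ.map f) := Measure.isProbabilityMeasure_map hf.aemeasurable
      refine ext_of_forall_integral_eq_of_IsFiniteMeasure fun g => ?_
      rw [integral_map hf.aemeasurable g.continuous.aestronglyMeasurable]
      have h := hzero g g.continuous
      rw [integral_sub (f := fun x => g (f x)) (hint (g.continuous.comp hf))
        (hint g.continuous)] at h
      exact sub_eq_zero.1 h
    intro B hB
    conv_rhs => rw [← hmap]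
    exact (Measure.map_apply hf.measurable hB).symm
  · intro H φ hφ
    have hμ : MeasurePreserving f μ μ :=
      ⟨hf.measurable, Measure.ext fun B hB => by rw [Measure.map_apply hf.measurable hB, H B hB]⟩
    set c := (∫ x, φ x ∂μ) / ∫ x, ψ x ∂μ with hc
    have hP : (c : EReal) ≤ inducedPressure f ψ φ := by
      refine le_inducedPressure hφ hm hψm fun n => ?_
      have hχ : Continuous fun x => φ x - c * ψ x := hφ.sub (continuous_const.mul hψ)
      have hbχ : Continuous (birkhoff f (fun x => φ x - c * ψ x) n) :=
        continuous_finsetSum _ fun i _ => hχ.comp (hf.iterate i)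
      obtain ⟨x, hx⟩ := exists_integral_le (hint hbχ)
      refine ⟨x, ?_⟩
      rw [integral_birkhoff hf hμ hχ, integral_sub (g := fun x => c * ψ x) (hint hφ)
        (hint (continuous_const.mul hψ)),
        integral_const_mul, hc, div_mul_cancel₀ _ hψint.ne', sub_self, mul_zero, ← hc,
        birkhoff_sub, birkhoff_const_mul] at hx
      exact sub_nonneg.1 hx
    calc ((∫ x, φ x ∂μ : ℝ) : EReal) = (c : EReal) * ((∫ x, ψ x ∂μ : ℝ) : EReal) := by
          rw [← EReal.coe_mul, hc, div_mul_cancel₀ _ hψint.ne']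
      _ ≤ _ := mul_le_mul_of_nonneg_right hP (by exact_mod_cast hψint.le)
end
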